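/- Assume F satisfies (F1), (F2) and (F3). Then the functions (t₁,t₂) ↦ λ⁺(t₁,t₂) and (t₁,t₂) ↦ λ⁻(t₁,t₂) are continuous on the set {(t₁,t₂) : a ≤ t₁ < t₂ ≤ b}, and λ⁺(t₁,t₂) → +∞ and λ⁻(t₁,t₂) → +∞ as t₂ − t₁ → 0⁺ (uniformly: for every M there is η > 0 such that 0 < t₂ − t₁ < η implies λ±(t₁,t₂) > M). -/

import Mathlib

open Set

/-- `u ∈ C²(c,d) ∩ C¹([c,d])`, with first derivative `u'` (one-sided at the endpoints)
and second derivative `u''` on the open interval. -/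
def C2Fun (c d : ℝ) (u u' u'' : ℝ → ℝ) : Prop :=
  (∀ t ∈ Set.Icc c d, HasDerivWithinAt u (u' t) (Set.Icc c d) t) ∧
  ContinuousOn u' (Set.Icc c d) ∧
  (∀ t ∈ Set.Ioo c d, HasDerivAt u' (u'' t) t) ∧
  ContinuousOn u'' (Set.Ioo c d)

/-- `μ = λ⁺(c,d)`: the problem `F(u'',u',u,t) = -μ u` on `(c,d)`, `u(c)=u(d)=0`,
has a solution which is positive on `(c,d)`. -/
def IsPosEigenvalue (F : ℝ → ℝ → ℝ → ℝ → ℝ) (c d μ : ℝ) : Prop :=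
  ∃ u u' u'' : ℝ → ℝ, C2Fun c d u u' u'' ∧
    (∀ t ∈ Set.Ioo c d, F (u'' t) (u' t) (u t) t = -μ * u t) ∧
    u c = 0 ∧ u d = 0 ∧ (∀ t ∈ Set.Ioo c d, 0 < u t)

/-- `μ = λ⁻(c,d)`: same with a negative solution. -/
def IsNegEigenvalue (F : ℝ → ℝ → ℝ → ℝ → ℝ) (c d μ : ℝ) : Prop :=
  ∃ u u' u'' : ℝ → ℝ, C2Fun c d u u' u'' ∧
    (∀ t ∈ Set.Ioo c d, F (u'' t) (u' t) (u t) t = -μ * u t) ∧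
    u c = 0 ∧ u d = 0 ∧ (∀ t ∈ Set.Ioo c d, u t < 0)

open Filter Topology

/-- The extremal operator of Pucci type that bounds the increments of `F` from above. -/
def pucciSup (lam Lam gam del m p u : ℝ) : ℝ :=
  Lam * max m 0 - lam * max (-m) 0 + gam * |p| + del * |u|

/-- Positive homogeneity and one-sided uniform ellipticity of `F` on `[a, b]`. -/
structure IsElliptic (a b lam Lam gam del : ℝ) (F : ℝ → ℝ → ℝ → ℝ → ℝ) : Prop where
  lam_pos : 0 < lam
  gam_pos : 0 < gam
  del_pos : 0 < del
  homog : ∀ s : ℝ, 0 ≤ s → ∀ m p u : ℝ, ∀ t ∈ Icc a b,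
    F (s * m) (s * p) (s * u) t = s * F m p u t
  sub_le : ∀ m p u m' p' u' : ℝ, ∀ t ∈ Icc a b,
    F m p u t - F m' p' u' t ≤ pucciSup lam Lam gam del (m - m') (p - p') (u - u')

theorem pucciSup_mul {lam Lam gam del s : ℝ} (hs : 0 ≤ s) (m p u : ℝ) :
    pucciSup lam Lam gam del (s * m) (s * p) (s * u) = s * pucciSup lam Lam gam del m p u := by
  have h1 : max (s * m) 0 = s * max m 0 := by rw [mul_max_of_nonneg _ _ hs, mul_zero]
  have h2 : max (-(s * m)) 0 = s * max (-m) 0 := by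
    rw [mul_max_of_nonneg _ _ hs, mul_zero, mul_neg]
  simp only [pucciSup, h1, h2, abs_mul, abs_of_nonneg hs]
  ring

theorem pucciSup_of_nonpos {lam Lam gam del m : ℝ} (hm : m ≤ 0) (p u : ℝ) :
    pucciSup lam Lam gam del m p u = lam * m + gam * |p| + del * |u| := by
  rw [pucciSup, max_eq_right hm, max_eq_left (by linarith)]
  ring

theorem Continuous.pucciSup {lam Lam gam del : ℝ} {m p u : ℝ → ℝ} (hm : Continuous m)
    (hp : Continuous p) (hu : Continuous u) :
    Continuous fun t => pucciSup lam Lam gam del (m t) (p t) (u t) := by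
  unfold _root_.pucciSup
  fun_prop

namespace IsElliptic

variable {a b lam Lam gam del : ℝ} {F : ℝ → ℝ → ℝ → ℝ → ℝ}

theorem map_zero (hF : IsElliptic a b lam Lam gam del F) {t : ℝ} (ht : t ∈ Icc a b) :
    F 0 0 0 t = 0 := by
  simpa using hF.homog 0 le_rfl 0 0 0 t ht

theorem le_pucciSup (hF : IsElliptic a b lam Lam gam del F) (m p u : ℝ) {t : ℝ}
    (ht : t ∈ Icc a b) : F m p u t ≤ pucciSup lam Lam gam del m p u := by
  have := hF.sub_le m p u 0 0 0 t ht
  simpa [hF.map_zero ht] using this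

theorem mono (hF : IsElliptic a b lam Lam gam del F) {m m' : ℝ} (hm : m ≤ m') (p u : ℝ) {t : ℝ}
    (ht : t ∈ Icc a b) : F m p u t ≤ F m' p u t := by
  have h := hF.sub_le m p u m' p u t ht
  rw [pucciSup_of_nonpos (by linarith)] at h
  simp only [sub_self, abs_zero, mul_zero, add_zero] at h
  nlinarith [hF.lam_pos]

end IsElliptic

theorem HasDerivWithinAt.nonpos_of_le_Ici {g : ℝ → ℝ} {g' t d : ℝ} (hd : t < d)
    (hg : HasDerivWithinAt g g' (Ici t) t) (hle : ∀ s ∈ Ioo t d, g s ≤ g t) : g' ≤ 0 := by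
  have h := hasDerivWithinAt_iff_tendsto_slope.1 hg
  rw [Ici_sdiff_left] at h
  refine le_of_tendsto h ?_
  filter_upwards [Ioo_mem_nhdsGT hd] with s hs
  rw [slope_def_field]
  exact div_nonpos_of_nonpos_of_nonneg (by linarith [hle s hs]) (by linarith [hs.1])

theorem HasDerivWithinAt.nonneg_of_le_Iic {g : ℝ → ℝ} {g' t c : ℝ} (hc : c < t)
    (hg : HasDerivWithinAt g g' (Iic t) t) (hle : ∀ s ∈ Ioo c t, g s ≤ g t) : 0 ≤ g' := by
  have h := hasDerivWithinAt_iff_tendsto_slope.1 hg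
  rw [Iic_sdiff_right] at h
  refine ge_of_tendsto h ?_
  filter_upwards [Ioo_mem_nhdsLT hc] with s hs
  rw [slope_def_field]
  exact div_nonneg_of_nonpos (by linarith [hle s hs]) (by linarith [hs.2])

theorem IsLocalMax.hasDerivAt_hasDerivAt_nonpos {g g' : ℝ → ℝ} {g'' t : ℝ} (hmax : IsLocalMax g t)
    (hg : ∀ᶠ s in 𝓝 t, HasDerivAt g (g' s) s) (hg' : HasDerivAt g' g'' t) : g'' ≤ 0 := by
  by_contra! hpos
  have hd : deriv g =ᶠ[𝓝 t] g' := hg.mono fun s hs => hs.deriv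
  have hdd : deriv (deriv g) t = g'' := by rw [hd.deriv_eq, hg'.deriv]
  have hmin : IsLocalMin g t := isLocalMin_of_deriv_deriv_pos (by rwa [hdd])
    hmax.deriv_eq_zero hg.self_of_nhds.continuousAt
  have hconst : g =ᶠ[𝓝 t] fun _ => g t := by
    filter_upwards [hmax, hmin] with s h1 h2 using le_antisymm h1 h2
  have hz : deriv g =ᶠ[𝓝 t] fun _ => 0 := by
    refine hconst.deriv.trans (Eventually.of_forall fun s => ?_)
    simp
  rw [hz.deriv_eq] at hdd
  simp at hdd
  linarith

/-- `φ` is at `t` either a classical supersolution of `F(φ'', φ', φ, t) + μ φ = 0`, or has a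
strictly concave kink. -/
def IsSuperAt (F : ℝ → ℝ → ℝ → ℝ → ℝ) (μ : ℝ) (φ : ℝ → ℝ) (t : ℝ) : Prop :=
  (∃ (φ' : ℝ → ℝ) (φ'' : ℝ), (∀ᶠ s in 𝓝 t, HasDerivAt φ (φ' s) s) ∧ HasDerivAt φ' φ'' t ∧
    F φ'' (φ' t) (φ t) t + μ * φ t ≤ 0) ∨
  ∃ A B : ℝ, B < A ∧ HasDerivWithinAt φ A (Iic t) t ∧ HasDerivWithinAt φ B (Ici t) t

/-- A positive supersolution with parameter `μ` and a subsolution with parameter `ν` which is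
nonpositive at the endpoints but positive somewhere force `μ ≤ ν`. -/
theorem le_of_super_of_sub {a b lam Lam gam del : ℝ} {F : ℝ → ℝ → ℝ → ℝ → ℝ}
    (hF : IsElliptic a b lam Lam gam del F) {c d μ ν : ℝ} {φ v v' v'' : ℝ → ℝ}
    (hsub : Icc c d ⊆ Icc a b)
    (hφ : ContinuousOn φ (Icc c d)) (hφpos : ∀ t ∈ Icc c d, 0 < φ t)
    (hφs : ∀ t ∈ Ioo c d, IsSuperAt F μ φ t)
    (hv : ContinuousOn v (Icc c d)) (hvc : v c ≤ 0) (hvd : v d ≤ 0)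
    (hvpos : ∃ t ∈ Ioo c d, 0 < v t)
    (hv1 : ∀ t ∈ Ioo c d, HasDerivAt v (v' t) t)
    (hv2 : ∀ t ∈ Ioo c d, HasDerivAt v' (v'' t) t)
    (hvs : ∀ t ∈ Ioo c d, 0 ≤ F (v'' t) (v' t) (v t) t + ν * v t) : μ ≤ ν := by
  obtain ⟨x, hx, hvx⟩ := hvpos
  obtain ⟨t, ht, hmax⟩ := isCompact_Icc.exists_isMaxOn ⟨x, Ioo_subset_Icc_self hx⟩
    (hv.div hφ fun s hs => (hφpos s hs).ne')
  obtain ⟨κ, hκ⟩ : ∃ κ, κ = v t / φ t := ⟨_, rfl⟩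
  have hmax' : ∀ s ∈ Icc c d, v s / φ s ≤ κ := fun s hs => hκ ▸ hmax hs
  have hκpos : 0 < κ := (div_pos hvx (hφpos x (Ioo_subset_Icc_self hx))).trans_le
    (hmax' x (Ioo_subset_Icc_self hx))
  have hvt : v t = κ * φ t := by rw [hκ, div_mul_cancel₀ _ (hφpos t ht).ne']
  have hle : ∀ s ∈ Icc c d, v s ≤ κ * φ s := fun s hs =>
    (div_le_iff₀ (hφpos s hs)).1 (hmax' s hs)
  have hvtpos : 0 < v t := hvt ▸ mul_pos hκpos (hφpos t ht)
  have htc : c < t := lt_of_le_of_ne ht.1 fun h => by rw [← h] at hvtpos; linarith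
  have htd : t < d := lt_of_le_of_ne ht.2 fun h => by rw [h] at hvtpos; linarith
  have htI : t ∈ Ioo c d := ⟨htc, htd⟩
  have hIn : Ioo c d ∈ 𝓝 t := Ioo_mem_nhds htc htd
  rcases hφs t htI with ⟨φ', φ'', h1, h2, h3⟩ | ⟨A, B, hBA, hA, hB⟩
  · have hloc : IsLocalMax (fun s => v s - κ * φ s) t := by
      filter_upwards [hIn] with s hs
      have := hle s (Ioo_subset_Icc_self hs)
      simp only [hvt, sub_self]
      linarith
    have hd1 : ∀ᶠ s in 𝓝 t, HasDerivAt (fun s => v s - κ * φ s) (v' s - κ * φ' s) s := by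
      filter_upwards [hIn, h1] with s hs h1s using (hv1 s hs).sub (h1s.const_mul κ)
    have hd2 : HasDerivAt (fun s => v' s - κ * φ' s) (v'' t - κ * φ'') t :=
      (hv2 t htI).sub (h2.const_mul κ)
    have e1 : v' t = κ * φ' t := by
      have := hloc.hasDerivAt_eq_zero hd1.self_of_nhds
      linarith
    have e2 : v'' t ≤ κ * φ'' := by
      have := hloc.hasDerivAt_hasDerivAt_nonpos hd1 hd2
      linarith
    have h4 := hvs t htI
    have h5 := hF.mono e2 (v' t) (v t) (hsub ht)
    rw [e1, hvt, hF.homog κ hκpos.le _ _ _ t (hsub ht)] at h5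
    rw [e1, hvt] at h4
    have h6 : 0 ≤ (ν - μ) * (κ * φ t) := by nlinarith
    have h7 : 0 < κ * φ t := mul_pos hκpos (hφpos t ht)
    by_contra! hlt
    nlinarith
  · have hR := ((hv1 t htI).hasDerivWithinAt.sub (hB.const_mul κ)).nonpos_of_le_Ici htd
      fun s hs => by
        have := hle s ⟨(htc.trans hs.1).le, hs.2.le⟩
        simp only [Pi.sub_apply, hvt, sub_self]
        linarith
    have hL := ((hv1 t htI).hasDerivWithinAt.sub (hA.const_mul κ)).nonneg_of_le_Iic htc
      fun s hs => by
        have := hle s ⟨hs.1.le, (hs.2.trans htd).le⟩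
        simp only [Pi.sub_apply, hvt, sub_self]
        linarith
    nlinarith

theorem exists_pos_forall_mul_le {c d : ℝ} {u B : ℝ → ℝ} (hu : ContinuousOn u (Icc c d))
    (hu0 : ∀ t ∈ Icc c d, 0 ≤ u t) (hupos : ∀ t ∈ Ioo c d, 0 < u t) (hB : Continuous B)
    (hBc : B c < 0) (hBd : B d < 0) :
    ∃ s₀ : ℝ, 0 < s₀ ∧ ∀ s, 0 < s → s ≤ s₀ → ∀ t ∈ Icc c d, s * B t ≤ u t ∧
      (B t < 0 ∨ s * B t < u t) := by
  have hS : IsCompact (Icc c d ∩ {t | 0 ≤ B t}) :=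
    isCompact_Icc.inter_right (isClosed_le continuous_const hB)
  rcases (Icc c d ∩ {t | 0 ≤ B t}).eq_empty_or_nonempty with hE | hne
  · refine ⟨1, one_pos, fun s hs _ t ht => ?_⟩
    have hBt : B t < 0 := by
      by_contra! h
      exact (hE ▸ (⟨ht, h⟩ : t ∈ Icc c d ∩ {t | 0 ≤ B t}) : t ∈ (∅ : Set ℝ))
    exact ⟨by nlinarith [hu0 t ht], Or.inl hBt⟩
  · obtain ⟨x, hx, hmin⟩ := hS.exists_isMinOn hne (hu.mono inter_subset_left)
    obtain ⟨y, hy, hmax⟩ := hS.exists_isMaxOn hne hB.continuousOn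
    have hxpos : 0 < u x := by
      refine hupos x ⟨lt_of_le_of_ne hx.1.1 ?_, lt_of_le_of_ne hx.1.2 ?_⟩
      · rintro rfl
        exact absurd hx.2 (not_le.2 hBc)
      · rintro rfl
        exact absurd hx.2 (not_le.2 hBd)
    have hy0 : 0 ≤ B y := hy.2
    refine ⟨u x / (B y + 1), by positivity, fun s hs hs' t ht => ?_⟩
    rcases lt_or_ge (B t) 0 with hBt | hBt
    · exact ⟨by nlinarith [hu0 t ht], Or.inl hBt⟩
    · have h1 : u x ≤ u t := hmin ⟨ht, hBt⟩
      have h2 : B t ≤ B y := hmax ⟨ht, hBt⟩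
      rw [le_div_iff₀ (by linarith)] at hs'
      have h3 : s * B t < u t := by nlinarith
      exact ⟨h3.le, Or.inr h3⟩

/-- A `C²` function equal to `1` at `c` and `d` and very concave there. -/
theorem exists_barrier {c d lam Lam gam del : ℝ} (hcd : c < d) (hlam : 0 < lam) (hdel : 0 < del)
    (m : ℝ) :
    ∃ h h' h'' : ℝ → ℝ, (∀ t, HasDerivAt h (h' t) t) ∧ (∀ t, HasDerivAt h' (h'' t) t) ∧
      Continuous h ∧ Continuous h' ∧ Continuous h'' ∧ h c = 1 ∧ h d = 1 ∧ (∀ t, h t ≤ 1) ∧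
      pucciSup lam Lam gam del (h'' c) (h' c) (h c) + m * |h c| < 0 ∧
      pucciSup lam Lam gam del (h'' d) (h' d) (h d) + m * |h d| < 0 := by
  have hL : 0 < (d - c) ^ 2 := by have := sub_pos.2 hcd; positivity
  obtain ⟨K, hK⟩ : ∃ K, K = (del + |m| + 1) / (2 * lam * (d - c) ^ 2) := ⟨_, rfl⟩
  have hK0 : 0 < K := by rw [hK]; positivity
  have hKe : K * (2 * lam * (d - c) ^ 2) = del + |m| + 1 := by
    rw [hK, div_mul_cancel₀ _ (by positivity)]
  have hm := le_abs_self m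
  refine ⟨fun t => 1 - K * ((t - c) ^ 2 * (t - d) ^ 2),
    fun t => -(K * (2 * (t - c) * (t - d) ^ 2 + (t - c) ^ 2 * (2 * (t - d)))),
    fun t => -(K * (2 * (t - d) ^ 2 + 8 * (t - c) * (t - d) + 2 * (t - c) ^ 2)),
    fun t => ?_, fun t => ?_, by fun_prop, by fun_prop, by fun_prop, by simp, by simp,
    fun t => ?_, ?_, ?_⟩
  · have h1 := ((hasDerivAt_id t).sub_const c).pow 2
    have h2 := ((hasDerivAt_id t).sub_const d).pow 2
    refine (((h1.mul h2).const_mul K).const_sub 1).congr_deriv ?_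
    simp
  · have h0 := (hasDerivAt_id t).sub_const c
    have h0' := (hasDerivAt_id t).sub_const d
    refine (((((h0.const_mul 2).mul (h0'.pow 2)).add ((h0.pow 2).mul (h0'.const_mul 2))).const_mul
      K).neg).congr_deriv ?_
    simp
    left
    ring
  · have : 0 ≤ K * ((t - c) ^ 2 * (t - d) ^ 2) := by positivity
    simp only
    linarith
  · rw [pucciSup_of_nonpos]
    · simp
      nlinarith
    · simp
      positivity
  · rw [pucciSup_of_nonpos]
    · simp
      nlinarith
    · simp
      positivity

theorem C2Fun.hasDerivAt {c d : ℝ} {u u' u'' : ℝ → ℝ} (hu : C2Fun c d u u' u'') {t : ℝ}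
    (ht : t ∈ Ioo c d) : HasDerivAt u (u' t) t :=
  (hu.1 t (Ioo_subset_Icc_self ht)).hasDerivAt (Icc_mem_nhds ht.1 ht.2)

theorem C2Fun.continuousOn {c d : ℝ} {u u' u'' : ℝ → ℝ} (hu : C2Fun c d u u' u'') :
    ContinuousOn u (Icc c d) := fun t ht => (hu.1 t ht).continuousWithinAt

section Continuity

variable {a b lam Lam gam del : ℝ} {F : ℝ → ℝ → ℝ → ℝ → ℝ}

theorem IsPosEigenvalue.eventually_le (hF : IsElliptic a b lam Lam gam del F) {t₁ t₂ μ : ℝ}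
    (ha : a ≤ t₁) (ht : t₁ < t₂) (hb : t₂ ≤ b) (hμ : IsPosEigenvalue F t₁ t₂ μ) {ε : ℝ}
    (hε : 0 < ε) :
    ∃ η : ℝ, 0 < η ∧ ∀ s₁ s₂ ν : ℝ, IsPosEigenvalue F s₁ s₂ ν →
      |s₁ - t₁| < η → |s₂ - t₂| < η → ν ≤ μ + ε := by
  obtain ⟨u, u', u'', hu, hueq, hu1, hu2, hupos⟩ := hμ
  obtain ⟨h, h', h'', hh1, hh2, hc0, hc1, hc2, hhc, hhd, hle1, hBc, hBd⟩ :=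
    exists_barrier (Lam := Lam) (gam := gam) ht hF.lam_pos hF.del_pos |μ + ε|
  have hu0 : ∀ t ∈ Icc t₁ t₂, 0 ≤ u t := fun t htI => by
    rcases eq_or_lt_of_le htI.1 with rfl | h1
    · exact hu1.ge
    rcases eq_or_lt_of_le htI.2 with rfl | h2
    · exact hu2.ge
    exact (hupos t ⟨h1, h2⟩).le
  have hBcont : Continuous fun t => pucciSup lam Lam gam del (h'' t) (h' t) (h t)
      + |μ + ε| * |h t| := (Continuous.pucciSup hc2 hc1 hc0).add (continuous_const.mul hc0.abs)
  obtain ⟨s₀, hs₀, hs⟩ := exists_pos_forall_mul_le (u := fun t => ε * u t)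
    (continuousOn_const.mul hu.continuousOn) (fun t htI => mul_nonneg hε.le (hu0 t htI))
    (fun t htI => mul_pos hε (hupos t htI)) hBcont hBc hBd
  have hmid : (t₁ + t₂) / 2 ∈ Ioo t₁ t₂ := ⟨by linarith, by linarith⟩
  have humid := hupos _ hmid
  obtain ⟨r, hr0, hrs, hru⟩ : ∃ r, 0 < r ∧ r ≤ s₀ ∧ r < u ((t₁ + t₂) / 2) :=
    ⟨min s₀ (u ((t₁ + t₂) / 2) / 2), lt_min hs₀ (by linarith), min_le_left _ _,
      (min_le_right _ _).trans_lt (by linarith)⟩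
  have hψ : ContinuousOn (fun t => u t - r * h t) (Icc t₁ t₂) :=
    hu.continuousOn.sub (continuous_const.mul hc0).continuousOn
  have hev1 : ∀ᶠ t in 𝓝[>] t₁, u t - r * h t < 0 := by
    have h1 := (hψ t₁ (left_mem_Icc.2 ht.le)).mono_of_mem_nhdsWithin (s := Ioi t₁)
      (Icc_mem_nhdsGT ht)
    refine h1.eventually_lt continuousWithinAt_const ?_
    beta_reduce
    rw [hu1, hhc]
    linarith
  have hev2 : ∀ᶠ t in 𝓝[<] t₂, u t - r * h t < 0 := by
    have h1 := (hψ t₂ (right_mem_Icc.2 ht.le)).mono_of_mem_nhdsWithin (s := Iio t₂)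
      (Icc_mem_nhdsLT ht)
    refine h1.eventually_lt continuousWithinAt_const ?_
    beta_reduce
    rw [hu2, hhd]
    linarith
  obtain ⟨e₁, he₁, hev1⟩ := (mem_nhdsGT_iff_exists_Ioo_subset).1 hev1
  obtain ⟨e₂, he₂, hev2⟩ := (mem_nhdsLT_iff_exists_Ioo_subset).1 hev2
  obtain ⟨η, hη0, hη1, hη2, hη3⟩ : ∃ η, 0 < η ∧ η < e₁ - t₁ ∧ η < t₂ - e₂ ∧
      η < (t₂ - t₁) / 2 := by
    simp only [mem_Ioi, mem_Iio] at he₁ he₂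
    obtain ⟨η, h0, h1⟩ := exists_between
      (lt_min (sub_pos.2 he₁) (lt_min (sub_pos.2 he₂) (half_pos (sub_pos.2 ht))))
    simp only [lt_min_iff] at h1
    exact ⟨η, h0, h1.1, h1.2.1, h1.2.2⟩
  refine ⟨η, hη0, fun s₁ s₂ ν hν hs₁ hs₂ => ?_⟩
  obtain ⟨v, v', v'', hv, hveq, -, -, hvpos⟩ := hν
  rw [abs_lt] at hs₁ hs₂
  have hsubv : Icc (t₁ + η) (t₂ - η) ⊆ Ioo s₁ s₂ := fun t h =>
    ⟨by linarith [h.1], by linarith [h.2]⟩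
  have hsubu : Icc (t₁ + η) (t₂ - η) ⊆ Ioo t₁ t₂ := fun t h =>
    ⟨by linarith [h.1], by linarith [h.2]⟩
  refine le_of_super_of_sub hF (c := t₁ + η) (d := t₂ - η) (φ := v)
    (v := fun t => u t - r * h t) (v' := fun t => u' t - r * h' t)
    (v'' := fun t => u'' t - r * h'' t) (fun t h => ?_) (hv.continuousOn.mono ?_)
    (fun t h => hvpos t (hsubv h)) (fun t h => Or.inl ?_)
    (hψ.mono (hsubu.trans Ioo_subset_Icc_self)) ?_ ?_ ?_ (fun t htI => ?_) (fun t htI => ?_)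
    (fun t htI => ?_)
  · exact ⟨by linarith [h.1], by linarith [h.2]⟩
  · exact hsubv.trans Ioo_subset_Icc_self
  · have hI := hsubv (Ioo_subset_Icc_self h)
    refine ⟨v', v'' t, ?_, hv.2.2.1 t hI, ?_⟩
    · filter_upwards [Ioo_mem_nhds hI.1 hI.2] with s hs using hv.hasDerivAt hs
    · rw [hveq t hI]
      linarith
  · exact (hev1 ⟨by linarith, by linarith⟩ : u (t₁ + η) - r * h (t₁ + η) < 0).le
  · exact (hev2 ⟨by linarith, by linarith⟩ : u (t₂ - η) - r * h (t₂ - η) < 0).le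
  · refine ⟨(t₁ + t₂) / 2, ⟨by linarith, by linarith⟩, ?_⟩
    nlinarith [hle1 ((t₁ + t₂) / 2)]
  · exact (hu.hasDerivAt (hsubu (Ioo_subset_Icc_self htI))).sub ((hh1 t).const_mul r)
  · exact (hu.2.2.1 t (hsubu (Ioo_subset_Icc_self htI))).sub ((hh2 t).const_mul r)
  · have hI := hsubu (Ioo_subset_Icc_self htI)
    have hab : t ∈ Icc a b := ⟨by linarith [hI.1], by linarith [hI.2]⟩
    have h1 := hF.sub_le (u'' t) (u' t) (u t) (u'' t - r * h'' t) (u' t - r * h' t)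
      (u t - r * h t) t hab
    simp only [sub_sub_cancel] at h1
    rw [pucciSup_mul hr0.le, hueq t hI] at h1
    have h2 := (hs r hr0 hrs t (Ioo_subset_Icc_self hI)).1
    have h3 : (μ + ε) * h t ≤ |μ + ε| * |h t| := by
      rw [← abs_mul]
      exact le_abs_self _
    have h4 := mul_le_mul_of_nonneg_left h3 hr0.le
    nlinarith

theorem IsPosEigenvalue.eventually_ge (hF : IsElliptic a b lam Lam gam del F) {t₁ t₂ μ : ℝ}
    (ha : a ≤ t₁) (ht : t₁ < t₂) (hb : t₂ ≤ b) (hμ : IsPosEigenvalue F t₁ t₂ μ) {ε : ℝ}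
    (hε : 0 < ε) :
    ∃ η : ℝ, 0 < η ∧ ∀ s₁ s₂ ν : ℝ, a ≤ s₁ → s₁ < s₂ → s₂ ≤ b → IsPosEigenvalue F s₁ s₂ ν →
      |s₁ - t₁| < η → |s₂ - t₂| < η → μ - ε ≤ ν := by
  obtain ⟨u, u', u'', hu, hueq, hu1, hu2, hupos⟩ := hμ
  obtain ⟨h, h', h'', hh1, hh2, hc0, hc1, hc2, hhc, hhd, hle1, hBc, hBd⟩ :=
    exists_barrier (Lam := Lam) (gam := gam) ht hF.lam_pos hF.del_pos |μ - ε|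
  have hu0 : ∀ t ∈ Icc t₁ t₂, 0 ≤ u t := fun t htI => by
    rcases eq_or_lt_of_le htI.1 with rfl | h1
    · exact hu1.ge
    rcases eq_or_lt_of_le htI.2 with rfl | h2
    · exact hu2.ge
    exact (hupos t ⟨h1, h2⟩).le
  have hBcont : Continuous fun t => pucciSup lam Lam gam del (h'' t) (h' t) (h t)
      + |μ - ε| * |h t| := (Continuous.pucciSup hc2 hc1 hc0).add (continuous_const.mul hc0.abs)
  obtain ⟨s₀, hs₀, hs⟩ := exists_pos_forall_mul_le (u := fun t => ε * u t)
    (continuousOn_const.mul hu.continuousOn) (fun t htI => mul_nonneg hε.le (hu0 t htI))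
    (fun t htI => mul_pos hε (hupos t htI)) hBcont hBc hBd
  obtain ⟨s₁, hs₁, hs'⟩ := exists_pos_forall_mul_le (u := u) (B := fun t => -h t)
    hu.continuousOn hu0 hupos hc0.neg (by simp [hhc]) (by simp [hhd])
  obtain ⟨r, hr0, hrs, hru⟩ : ∃ r, 0 < r ∧ r ≤ s₀ ∧ r ≤ s₁ :=
    ⟨min s₀ s₁, lt_min hs₀ hs₁, min_le_left _ _, min_le_right _ _⟩
  -- the quadratic pieces `x ↦ ± A (x - tᵢ) - K (x - tᵢ)²` extend `u` with concave kinks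
  have hquad : ∀ A x₀ : ℝ, ∃ q q' q'' : ℝ → ℝ, (∀ t, HasDerivAt q (q' t) t) ∧
      (∀ t, HasDerivAt q' (q'' t) t) ∧ q x₀ = 0 ∧ q' x₀ = A ∧ (h x₀ = 1 →
      pucciSup lam Lam gam del (h'' x₀) (h' x₀) (h x₀) + |μ - ε| * |h x₀| < 0 →
      ∀ᶠ t in 𝓝 x₀, 0 < q t + r * h t ∧ (t ∈ Icc a b →
        F (q'' t + r * h'' t) (q' t + r * h' t) (q t + r * h t) t
          + (μ - ε) * (q t + r * h t) ≤ 0)) := by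
    intro A x₀
    have hlam := hF.lam_pos
    have hgam := hF.gam_pos
    obtain ⟨K, hK⟩ : ∃ K, K = (gam * |A| + 1) / (2 * lam) := ⟨_, rfl⟩
    have hK0 : 0 < K := by rw [hK]; positivity
    have hKe : K * (2 * lam) = gam * |A| + 1 := by rw [hK, div_mul_cancel₀ _ (by positivity)]
    have hq0 : Continuous fun t => A * (t - x₀) - K * (t - x₀) ^ 2 := by fun_prop
    have hq1 : Continuous fun t => A - K * (2 * (t - x₀)) := by fun_prop
    refine ⟨fun t => A * (t - x₀) - K * (t - x₀) ^ 2, fun t => A - K * (2 * (t - x₀)),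
      fun _ => -(K * 2), fun t => ?_, fun t => ?_, by simp, by simp, fun hx hBx => ?_⟩
    · have h0 := (hasDerivAt_id t).sub_const x₀
      refine ((h0.const_mul A).sub ((h0.pow 2).const_mul K)).congr_deriv ?_
      simp
    · have h0 := (hasDerivAt_id t).sub_const x₀
      refine (((h0.const_mul 2).const_mul K).const_sub A).congr_deriv ?_
      simp
    · have hQ : Continuous fun t => pucciSup lam Lam gam del (-(K * 2)) (A - K * (2 * (t - x₀)))
          (A * (t - x₀) - K * (t - x₀) ^ 2) + |μ - ε| * |A * (t - x₀) - K * (t - x₀) ^ 2| :=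
        (Continuous.pucciSup continuous_const hq1 hq0).add (continuous_const.mul hq0.abs)
      have hQx : pucciSup lam Lam gam del (-(K * 2)) (A - K * (2 * (x₀ - x₀)))
          (A * (x₀ - x₀) - K * (x₀ - x₀) ^ 2)
          + |μ - ε| * |A * (x₀ - x₀) - K * (x₀ - x₀) ^ 2| < 0 := by
        rw [pucciSup_of_nonpos (by linarith)]
        simp
        nlinarith
      have hqh : Continuous fun t => A * (t - x₀) - K * (t - x₀) ^ 2 + r * h t :=
        hq0.add (continuous_const.mul hc0)
      have hqhx : 0 < A * (x₀ - x₀) - K * (x₀ - x₀) ^ 2 + r * h x₀ := by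
        rw [hx]
        simpa using hr0
      have e1 := (hqh.tendsto x₀).eventually (lt_mem_nhds hqhx)
      have e2 := (hQ.tendsto x₀).eventually (gt_mem_nhds hQx)
      have e3 := (hBcont.tendsto x₀).eventually (gt_mem_nhds hBx)
      filter_upwards [e1, e2, e3] with t h1 h2 h3
      refine ⟨h1, fun hab => ?_⟩
      have h4 := hF.sub_le (-(K * 2) + r * h'' t) (A - K * (2 * (t - x₀)) + r * h' t)
        (A * (t - x₀) - K * (t - x₀) ^ 2 + r * h t) (-(K * 2)) (A - K * (2 * (t - x₀)))
        (A * (t - x₀) - K * (t - x₀) ^ 2) t hab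
      simp only [add_sub_cancel_left] at h4
      rw [pucciSup_mul hr0.le] at h4
      have h5 := hF.le_pucciSup (-(K * 2)) (A - K * (2 * (t - x₀)))
        (A * (t - x₀) - K * (t - x₀) ^ 2) hab
      generalize A * (t - x₀) - K * (t - x₀) ^ 2 = q at *
      have h6 : (μ - ε) * q ≤ |μ - ε| * |q| := by
        rw [← abs_mul]
        exact le_abs_self _
      have h7 : (μ - ε) * h t ≤ |μ - ε| * |h t| := by
        rw [← abs_mul]
        exact le_abs_self _
      have h8 := mul_le_mul_of_nonneg_left h7 hr0.le
      have h9 := mul_neg_of_pos_of_neg hr0 h3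
      nlinarith
  obtain ⟨l, l', l'', hl1, hl2, hl0, hlA, hlev⟩ := hquad (u' t₁ + 1) t₁
  obtain ⟨q, q', q'', hq1, hq2, hq0, hqA, hqev⟩ := hquad (u' t₂ - 1) t₂
  obtain ⟨η₁, hη₁, hlev⟩ := Metric.eventually_nhds_iff.1 (hlev hhc hBc)
  obtain ⟨η₂, hη₂, hqev⟩ := Metric.eventually_nhds_iff.1 (hqev hhd hBd)
  simp only [Real.dist_eq] at hlev hqev
  refine ⟨min η₁ η₂, lt_min hη₁ hη₂, fun s₁ s₂ ν hsa hss hsb hν hs₁ hs₂ => ?_⟩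
  obtain ⟨v, v', v'', hv, hveq, hv1, hv2, hvpos⟩ := hν
  rw [lt_min_iff] at hs₁ hs₂
  have hs₁' := abs_lt.1 hs₁.1
  have hs₂' := abs_lt.1 hs₂.2
  obtain ⟨φ, hφ⟩ : ∃ φ : ℝ → ℝ, φ = fun t =>
    (if t ≤ t₁ then l t else if t ≤ t₂ then u t else q t) + r * h t := ⟨_, rfl⟩
  have hφl : ∀ t ≤ t₁, φ t = l t + r * h t := fun t h => by simp [hφ, h]
  have hφu : ∀ t ∈ Icc t₁ t₂, φ t = u t + r * h t := fun t hI => by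
    rcases eq_or_lt_of_le hI.1 with rfl | h1
    · simp [hφ, hl0, hu1]
    · simp [hφ, not_le.2 h1, hI.2]
  have hφq : ∀ t, t₂ ≤ t → φ t = q t + r * h t := fun t h => by
    rcases eq_or_lt_of_le h with rfl | h1
    · rw [hφu _ (right_mem_Icc.2 ht.le), hu2, hq0]
    · simp [hφ, not_le.2 h1, not_le.2 (ht.trans h1)]
  have hdl : ∀ t, HasDerivAt (fun t => l t + r * h t) (l' t + r * h' t) t := fun t =>
    (hl1 t).add ((hh1 t).const_mul r)
  have hdq : ∀ t, HasDerivAt (fun t => q t + r * h t) (q' t + r * h' t) t := fun t =>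
    (hq1 t).add ((hh1 t).const_mul r)
  have hdu : ∀ t ∈ Icc t₁ t₂,
      HasDerivWithinAt (fun t => u t + r * h t) (u' t + r * h' t) (Icc t₁ t₂) t := fun t hI =>
    (hu.1 t hI).add ((hh1 t).const_mul r).hasDerivWithinAt
  have hpos : ∀ t ∈ Icc s₁ s₂, 0 < φ t := fun t hI => by
    rcases le_or_gt t t₁ with h1 | h1
    · rw [hφl t h1]
      exact (hlev (abs_lt.2 ⟨by linarith [hI.1], by linarith⟩)).1
    rcases le_or_gt t₂ t with h2 | h2
    · rw [hφq t h2]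
      exact (hqev (abs_lt.2 ⟨by linarith, by linarith [hI.2]⟩)).1
    · rw [hφu t ⟨h1.le, h2.le⟩]
      have h3 := hupos t ⟨h1, h2⟩
      rcases (hs' r hr0 hru t ⟨h1.le, h2.le⟩).2 with h4 | h4
      · have : 0 < r * h t := mul_pos hr0 (by linarith)
        linarith
      · linarith
  have hsuper : ∀ t ∈ Icc s₁ s₂, ContinuousAt φ t ∧ IsSuperAt F (μ - ε) φ t := fun t hI => by
    have hab : t ∈ Icc a b := ⟨hsa.trans hI.1, hI.2.trans hsb⟩
    rcases lt_trichotomy t t₁ with h1 | rfl | h1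
    · have hev : ∀ᶠ s in 𝓝 t, HasDerivAt φ (l' s + r * h' s) s := by
        filter_upwards [eventually_eventually_nhds.2 (gt_mem_nhds h1)] with s hs
        exact (hdl s).congr_of_eventuallyEq (hs.mono fun x hx => hφl x hx.le)
      refine ⟨hev.self_of_nhds.continuousAt, Or.inl ⟨_, _, hev,
        (hl2 t).add ((hh2 t).const_mul r), ?_⟩⟩
      rw [hφl t h1.le]
      exact (hlev (abs_lt.2 ⟨by linarith [hI.1], by linarith⟩)).2 hab
    · have hA : HasDerivWithinAt φ (l' t + r * h' t) (Iic t) t :=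
        (hdl t).hasDerivWithinAt.congr (fun x hx => hφl x hx) (hφl t le_rfl)
      have hB : HasDerivWithinAt φ (u' t + r * h' t) (Ici t) t :=
        ((hdu t (left_mem_Icc.2 ht.le)).congr hφu (hφu t (left_mem_Icc.2 ht.le))
          ).mono_of_mem_nhdsWithin (Icc_mem_nhdsGE ht)
      exact ⟨continuousAt_iff_continuous_left_right.2
        ⟨hA.continuousWithinAt, hB.continuousWithinAt⟩, Or.inr ⟨_, _, by linarith, hA, hB⟩⟩
    rcases lt_trichotomy t t₂ with h2 | rfl | h2
    · have hev : ∀ᶠ s in 𝓝 t, HasDerivAt φ (u' s + r * h' s) s := by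
        filter_upwards [eventually_eventually_nhds.2 (Ioo_mem_nhds h1 h2)] with s hs
        have hs0 : s ∈ Ioo t₁ t₂ := hs.self_of_nhds
        exact ((hu.hasDerivAt hs0).add ((hh1 s).const_mul r)).congr_of_eventuallyEq
          (hs.mono fun x hx => hφu x (Ioo_subset_Icc_self hx))
      refine ⟨hev.self_of_nhds.continuousAt, Or.inl ⟨_, _, hev,
        (hu.2.2.1 t ⟨h1, h2⟩).add ((hh2 t).const_mul r), ?_⟩⟩
      rw [hφu t ⟨h1.le, h2.le⟩]
      have h3 := hF.sub_le (u'' t + r * h'' t) (u' t + r * h' t) (u t + r * h t)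
        (u'' t) (u' t) (u t) t hab
      simp only [add_sub_cancel_left] at h3
      rw [pucciSup_mul hr0.le, hueq t ⟨h1, h2⟩] at h3
      have h4 := (hs r hr0 hrs t ⟨h1.le, h2.le⟩).1
      have h5 : (μ - ε) * h t ≤ |μ - ε| * |h t| := by
        rw [← abs_mul]
        exact le_abs_self _
      have h6 := mul_le_mul_of_nonneg_left h5 hr0.le
      nlinarith
    · have hA : HasDerivWithinAt φ (u' t + r * h' t) (Iic t) t :=
        ((hdu t (right_mem_Icc.2 ht.le)).congr hφu (hφu t (right_mem_Icc.2 ht.le))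
          ).mono_of_mem_nhdsWithin (Icc_mem_nhdsLE ht)
      have hB : HasDerivWithinAt φ (q' t + r * h' t) (Ici t) t :=
        (hdq t).hasDerivWithinAt.congr (fun x hx => hφq x hx) (hφq t le_rfl)
      exact ⟨continuousAt_iff_continuous_left_right.2
        ⟨hA.continuousWithinAt, hB.continuousWithinAt⟩, Or.inr ⟨_, _, by linarith, hA, hB⟩⟩
    · have hev : ∀ᶠ s in 𝓝 t, HasDerivAt φ (q' s + r * h' s) s := by
        filter_upwards [eventually_eventually_nhds.2 (lt_mem_nhds h2)] with s hs
        exact (hdq s).congr_of_eventuallyEq (hs.mono fun x hx => hφq x hx.le)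
      refine ⟨hev.self_of_nhds.continuousAt, Or.inl ⟨_, _, hev,
        (hq2 t).add ((hh2 t).const_mul r), ?_⟩⟩
      rw [hφq t h2.le]
      exact (hqev (abs_lt.2 ⟨by linarith, by linarith [hI.2]⟩)).2 hab
  refine le_of_super_of_sub hF (Icc_subset_Icc hsa hsb)
    (fun t h => (hsuper t h).1.continuousWithinAt) hpos
    (fun t h => (hsuper t (Ioo_subset_Icc_self h)).2) hv.continuousOn hv1.le hv2.le
    ⟨(s₁ + s₂) / 2, ⟨by linarith, by linarith⟩, hvpos _ ⟨by linarith, by linarith⟩⟩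
    (fun t h => hv.hasDerivAt h) hv.2.2.1 (fun t h => ?_)
  rw [hveq t h]
  linarith

theorem IsPosEigenvalue.continuity (hF : IsElliptic a b lam Lam gam del F) {t₁ t₂ μ : ℝ}
    (ha : a ≤ t₁) (ht : t₁ < t₂) (hb : t₂ ≤ b) (hμ : IsPosEigenvalue F t₁ t₂ μ) {ε : ℝ}
    (hε : 0 < ε) :
    ∃ η : ℝ, 0 < η ∧ ∀ s₁ s₂ ν : ℝ, a ≤ s₁ → s₁ < s₂ → s₂ ≤ b → IsPosEigenvalue F s₁ s₂ ν →
      |s₁ - t₁| < η → |s₂ - t₂| < η → |ν - μ| < ε := by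
  obtain ⟨η₁, h₁, H₁⟩ := hμ.eventually_le hF ha ht hb (half_pos hε)
  obtain ⟨η₂, h₂, H₂⟩ := hμ.eventually_ge hF ha ht hb (half_pos hε)
  refine ⟨min η₁ η₂, lt_min h₁ h₂, fun s₁ s₂ ν hsa hss hsb hν hs₁ hs₂ => ?_⟩
  rw [lt_min_iff] at hs₁ hs₂
  have h3 := H₁ s₁ s₂ ν hν hs₁.1 hs₂.1
  have h4 := H₂ s₁ s₂ ν hsa hss hsb hν hs₁.2 hs₂.2
  exact abs_lt.2 ⟨by linarith, by linarith⟩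

theorem IsElliptic.exists_forall_lt_of_isPosEigenvalue (hF : IsElliptic a b lam Lam gam del F)
    (M : ℝ) :
    ∃ η : ℝ, 0 < η ∧ ∀ t₁ t₂ μ : ℝ, a ≤ t₁ → t₁ < t₂ → t₂ ≤ b → t₂ - t₁ < η →
      IsPosEigenvalue F t₁ t₂ μ → M < μ := by
  have hlam := hF.lam_pos
  have hgam := hF.gam_pos
  have hdel := hF.del_pos
  obtain ⟨K, hK⟩ : ∃ K, K = (del + |M + 1|) / lam := ⟨_, rfl⟩
  have hK0 : 0 < K := by rw [hK]; positivity
  have hKe : K * lam = del + |M + 1| := by rw [hK, div_mul_cancel₀ _ hlam.ne']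
  obtain ⟨η, hη0, hη1, hη2, hη3⟩ : ∃ η, 0 < η ∧ η ≤ 1 ∧ K * η < 1 ∧ gam * (2 * η) < lam := by
    obtain ⟨η, h0, h1⟩ := exists_between (lt_min one_pos
      (lt_min (inv_pos.2 hK0) (div_pos hlam (mul_pos two_pos hgam))))
    simp only [lt_min_iff] at h1
    refine ⟨η, h0, h1.1.le, ?_, ?_⟩
    · have := mul_lt_mul_of_pos_left h1.2.1 hK0
      rwa [mul_inv_cancel₀ hK0.ne'] at this
    · have := (lt_div_iff₀ (mul_pos two_pos hgam)).1 h1.2.2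
      linarith
  refine ⟨η, hη0, fun t₁ t₂ μ ha ht hb hlt hμ => ?_⟩
  obtain ⟨v, v', v'', hv, hveq, hv1, hv2, hvpos⟩ := hμ
  have hsub : Icc t₁ t₂ ⊆ Icc a b := Icc_subset_Icc ha hb
  have hφ : ∀ t ∈ Icc t₁ t₂, 0 < 1 - K * (t - t₁) ^ 2 := fun t hI => by
    have h1 : 0 ≤ t - t₁ := by linarith [hI.1]
    have h2 : t - t₁ ≤ η := by linarith [hI.2]
    have h3 : (t - t₁) ^ 2 ≤ η := by nlinarith
    nlinarith
  have key : M + 1 ≤ μ := by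
    refine le_of_super_of_sub hF hsub (φ := fun t => 1 - K * (t - t₁) ^ 2)
      (by fun_prop) hφ (fun t hI => Or.inl ⟨fun t => -(K * (2 * (t - t₁))), -(K * 2),
        Eventually.of_forall fun s => ?_, ?_, ?_⟩) hv.continuousOn hv1.le hv2.le
      ⟨(t₁ + t₂) / 2, ⟨by linarith, by linarith⟩, hvpos _ ⟨by linarith, by linarith⟩⟩
      (fun t h => hv.hasDerivAt h) hv.2.2.1 (fun t h => ?_)
    · have h0 := (hasDerivAt_id s).sub_const t₁
      refine (((h0.pow 2).const_mul K).const_sub 1).congr_deriv ?_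
      simp
    · have h0 := (hasDerivAt_id t).sub_const t₁
      refine ((h0.const_mul 2).const_mul K).neg.congr_deriv ?_
      simp
    · have hI' := Ioo_subset_Icc_self hI
      have h1 := hF.le_pucciSup (-(K * 2)) (-(K * (2 * (t - t₁)))) (1 - K * (t - t₁) ^ 2)
        (hsub hI')
      beta_reduce
      have h2 : 0 < t - t₁ := sub_pos.2 hI.1
      have h3 : t - t₁ < η := by linarith [hI.2]
      have h4 := hφ t hI'
      have h5 : 1 - K * (t - t₁) ^ 2 ≤ 1 := by nlinarith [mul_nonneg hK0.le (sq_nonneg (t - t₁))]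
      rw [pucciSup_of_nonpos (by linarith), abs_neg, abs_of_pos (by positivity),
        abs_of_pos h4] at h1
      generalize 1 - K * (t - t₁) ^ 2 = y at *
      have h6 : (M + 1) * y ≤ |M + 1| := by
        calc (M + 1) * y ≤ |M + 1| * y := mul_le_mul_of_nonneg_right (le_abs_self _) h4.le
          _ ≤ |M + 1| := mul_le_of_le_one_right (abs_nonneg _) h5
      have h7 : gam * (K * (2 * (t - t₁))) ≤ K * lam := by
        have : K * (gam * (2 * (t - t₁))) ≤ K * lam :=
          mul_le_mul_of_nonneg_left (by nlinarith) hK0.le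
        linarith
      have h8 : del * y ≤ del := mul_le_of_le_one_right hdel.le h5
      linarith
    · rw [hveq t h]
      linarith
  linarith

end Continuity

theorem IsNegEigenvalue.isPosEigenvalue_neg {F : ℝ → ℝ → ℝ → ℝ → ℝ} {c d μ : ℝ}
    (h : IsNegEigenvalue F c d μ) :
    IsPosEigenvalue (fun m p u t => -F (-m) (-p) (-u) t) c d μ := by
  obtain ⟨u, u', u'', hu, hueq, hu1, hu2, huneg⟩ := h
  refine ⟨fun t => -u t, fun t => -u' t, fun t => -u'' t,
    ⟨fun t h => (hu.1 t h).neg, hu.2.1.neg, fun t h => (hu.2.2.1 t h).neg, hu.2.2.2.neg⟩,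
    fun t h => ?_, by simp [hu1], by simp [hu2], fun t h => neg_pos.2 (huneg t h)⟩
  simp only [neg_neg]
  rw [hueq t h]
  ring

/-- continuity of `(t₁,t₂) ↦ λ±(t₁,t₂)` on `{a ≤ t₁ < t₂ ≤ b}` (expressed
via the defining property of the semi-eigenvalues), and uniform blow-up as
`t₂ - t₁ → 0⁺`. -/
theorem stmt_8
    (a b lam Lam gam del : ℝ) (hab : a < b)
    (hlam : 0 < lam) (hLam : lam ≤ Lam) (hgam : 0 < gam) (hdel : 0 < del)
    (F : ℝ → ℝ → ℝ → ℝ → ℝ)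
    (hFcont : ContinuousOn (fun z : ℝ × ℝ × ℝ × ℝ => F z.1 z.2.1 z.2.2.1 z.2.2.2)
      {z : ℝ × ℝ × ℝ × ℝ | z.2.2.2 ∈ Icc a b})
    (hF1 : ∀ s : ℝ, 0 ≤ s → ∀ m p u : ℝ, ∀ t ∈ Icc a b,
      F (s * m) (s * p) (s * u) t = s * F m p u t)
    (hF2 : ∀ m p u m' p' u' : ℝ, ∀ t ∈ Icc a b,
      lam * max (m - m') 0 - Lam * max (-(m - m')) 0 - gam * |p - p'| - del * |u - u'|
          ≤ F m p u t - F m' p' u' t ∧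
        F m p u t - F m' p' u' t
          ≤ Lam * max (m - m') 0 - lam * max (-(m - m')) 0 + gam * |p - p'| + del * |u - u'|)
    (hF3 : ∀ m p u m' p' u' : ℝ, ∀ t ∈ Icc a b,
      -F (m' - m) (p' - p) (u' - u) t ≤ F m p u t - F m' p' u' t ∧
        F m p u t - F m' p' u' t ≤ F (m - m') (p - p') (u - u') t) :
    -- continuity of λ⁺
    (∀ t₁ t₂ μ : ℝ, a ≤ t₁ → t₁ < t₂ → t₂ ≤ b → IsPosEigenvalue F t₁ t₂ μ →
      ∀ ε : ℝ, 0 < ε → ∃ η : ℝ, 0 < η ∧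
        ∀ s₁ s₂ ν : ℝ, a ≤ s₁ → s₁ < s₂ → s₂ ≤ b → IsPosEigenvalue F s₁ s₂ ν →
          |s₁ - t₁| < η → |s₂ - t₂| < η → |ν - μ| < ε) ∧
    -- continuity of λ⁻
    (∀ t₁ t₂ μ : ℝ, a ≤ t₁ → t₁ < t₂ → t₂ ≤ b → IsNegEigenvalue F t₁ t₂ μ →
      ∀ ε : ℝ, 0 < ε → ∃ η : ℝ, 0 < η ∧
        ∀ s₁ s₂ ν : ℝ, a ≤ s₁ → s₁ < s₂ → s₂ ≤ b → IsNegEigenvalue F s₁ s₂ ν →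
          |s₁ - t₁| < η → |s₂ - t₂| < η → |ν - μ| < ε) ∧
    -- uniform blow-up as t₂ - t₁ → 0⁺
    (∀ M : ℝ, ∃ η : ℝ, 0 < η ∧
      ∀ t₁ t₂ μ : ℝ, a ≤ t₁ → t₁ < t₂ → t₂ ≤ b → t₂ - t₁ < η →
        (IsPosEigenvalue F t₁ t₂ μ ∨ IsNegEigenvalue F t₁ t₂ μ) → M < μ) := by
  have hF : IsElliptic a b lam Lam gam del F := ⟨hlam, hgam, hdel, hF1,
    fun m p u m' p' u' t ht => (hF2 m p u m' p' u' t ht).2⟩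
  have hG : IsElliptic a b lam Lam gam del (fun m p u t => -F (-m) (-p) (-u) t) := by
    refine ⟨hlam, hgam, hdel, fun s hs m p u t ht => ?_, fun m p u m' p' u' t ht => ?_⟩
    · have := hF1 s hs (-m) (-p) (-u) t ht
      simp only [mul_neg] at this ⊢
      rw [this]
    · have := (hF2 (-m') (-p') (-u') (-m) (-p) (-u) t ht).2
      simp only [sub_neg_eq_add, neg_add_eq_sub] at this ⊢
      rw [pucciSup]
      linarith
  refine ⟨fun t₁ t₂ μ ha ht hb hμ ε hε => hμ.continuity hF ha ht hb hε,
    fun t₁ t₂ μ ha ht hb hμ ε hε => ?_, fun M => ?_⟩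
  · obtain ⟨η, hη, H⟩ := hμ.isPosEigenvalue_neg.continuity hG ha ht hb hε
    exact ⟨η, hη, fun s₁ s₂ ν hsa hss hsb hν => H s₁ s₂ ν hsa hss hsb hν.isPosEigenvalue_neg⟩
  · obtain ⟨η₁, h₁, H₁⟩ := hF.exists_forall_lt_of_isPosEigenvalue M
    obtain ⟨η₂, h₂, H₂⟩ := hG.exists_forall_lt_of_isPosEigenvalue M
    refine ⟨min η₁ η₂, lt_min h₁ h₂, fun t₁ t₂ μ ha ht hb hlt hμ => ?_⟩
    rw [lt_min_iff] at hlt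
    rcases hμ with hμ | hμ
    · exact H₁ t₁ t₂ μ ha ht hb hlt.1 hμ
    · exact H₂ t₁ t₂ μ ha ht hb hlt.2 hμ.isPosEigenvalue_neg
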